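/- arXiv:2306.06874 — 7 statements merged into one kernel-verified Lean document; each statement's English description precedes it below -/
import Mathlib

section
/- Let d ∈ ℕ, let p : EuclideanSpace ℝ (Fin d) → ℝ be twice continuously differentiable with p(x) > 0 for every x, let f : EuclideanSpace ℝ (Fin d) → EuclideanSpace ℝ (Fin d) be differentiable, and let g, ζ ∈ ℝ. Then for every x, −∑_{i} ∂_i( (f · p) )_i(x) + (g²/2)·∑_i ∂_i∂_i p(x) = −∑_i ∂_i( (f_i − ((1−ζ)·g²/2)·∂_i(log ∘ p))·p )(x) + (ζ·g²/2)·∑_i ∂_i∂_i p(x), where ( (f·p) )_i denotes the function y ↦ f_i(y)·p(y). In other words, replacing the drift f by f − ((1−ζ)g²/2)·∇ log p and scaling the diffusion term g² by ζ leaves the Fokker–Planck right-hand side unchanged on everywhere-positive twice-differentiable densities. -/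
open Real

/-- The log-derivative identity `∂_v (log ∘ p) · p = ∂_v p` for a nonvanishing function. -/
theorem fderiv_log_apply_mul_self {E : Type*} [NormedAddCommGroup E] [NormedSpace ℝ E]
    {p : E → ℝ} {y : E} (hp : DifferentiableAt ℝ p y) (hy : p y ≠ 0) (v : E) :
    fderiv ℝ (fun z => Real.log (p z)) y v * p y = fderiv ℝ p y v := by
  rw [fderiv.log hp hy, smul_apply, smul_eq_mul]
  field_simp

/-- Replacing the drift component `a` by `a - c * ∂_v (log ∘ p)` changes the derivative of the
flux `a * p` along `v` by `-c * ∂_v ∂_v p`. -/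
theorem fderiv_sub_const_mul_fderiv_log_mul_apply {E : Type*} [NormedAddCommGroup E]
    [NormedSpace ℝ E] {p a : E → ℝ} (hp : ContDiff ℝ 2 p) (hp0 : ∀ y, p y ≠ 0)
    {x : E} (ha : DifferentiableAt ℝ a x) (c : ℝ) (v : E) :
    fderiv ℝ (fun y => (a y - c * fderiv ℝ (fun z => Real.log (p z)) y v) * p y) x v
      = fderiv ℝ (fun y => a y * p y) x v - c * fderiv ℝ (fun y => fderiv ℝ p y v) x v := by
  have hpd : Differentiable ℝ p := hp.differentiable (by norm_num)
  have hp' : Differentiable ℝ (fun y => fderiv ℝ p y v) :=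
    ((hp.fderiv_right (m := 1) (by norm_num)).differentiable (by norm_num)).clm_apply
      (differentiable_const v)
  have hflux : (fun y => (a y - c * fderiv ℝ (fun z => Real.log (p z)) y v) * p y)
      = fun y => a y * p y - c * fderiv ℝ p y v := by
    funext y
    rw [sub_mul, mul_assoc, fderiv_log_apply_mul_self (hpd y) (hp0 y)]
  rw [hflux, fderiv_fun_sub (ha.fun_mul (hpd x)) ((hp' x).const_mul c),
    fderiv_const_mul (hp' x) c]
  simp

/-- Fokker–Planck right-hand side invariance: replacing the drift `f` by
`f − ((1−ζ)g²/2)·∇ log p` and scaling the diffusion coefficient `g²` by `ζ`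
leaves the Fokker–Planck right-hand side unchanged on everywhere-positive
twice continuously differentiable densities. -/
theorem fokker_planck_drift_adjustment (d : ℕ)
    (p : EuclideanSpace ℝ (Fin d) → ℝ) (hp : ContDiff ℝ 2 p)
    (hppos : ∀ x, 0 < p x)
    (f : EuclideanSpace ℝ (Fin d) → EuclideanSpace ℝ (Fin d))
    (hf : Differentiable ℝ f) (g ζ : ℝ) (x : EuclideanSpace ℝ (Fin d)) :
    -(∑ i : Fin d,
        fderiv ℝ (fun y => f y i * p y) x (EuclideanSpace.single i 1))
      + (g ^ 2 / 2) * ∑ i : Fin d,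
          fderiv ℝ (fun y => fderiv ℝ p y (EuclideanSpace.single i 1)) x
            (EuclideanSpace.single i 1)
    =
    -(∑ i : Fin d,
        fderiv ℝ
          (fun y =>
            (f y i - ((1 - ζ) * g ^ 2 / 2) *
                fderiv ℝ (fun z => Real.log (p z)) y (EuclideanSpace.single i 1)) * p y)
          x (EuclideanSpace.single i 1))
      + (ζ * g ^ 2 / 2) * ∑ i : Fin d,
          fderiv ℝ (fun y => fderiv ℝ p y (EuclideanSpace.single i 1)) x
            (EuclideanSpace.single i 1) := by
  have hfi (i : Fin d) : DifferentiableAt ℝ (fun y => f y i) x :=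
    (differentiableAt_euclidean.1 (hf x)) i
  simp only [fderiv_sub_const_mul_fderiv_log_mul_apply hp (fun y => (hppos y).ne') (hfi _),
    Finset.sum_sub_distrib, ← Finset.mul_sum]
  ring
end

section
/- Let V be a real vector space, let k, w : ℕ → ℝ, let ρ̂ : ℕ → ℝ with ρ̂(0) = 0, and define h(t) := ρ̂(t) − k(t)·ρ̂(t−1) for t ≥ 1. Let ε : ℕ → V, x₀′ ∈ V, r ∈ V, and define x′ : ℕ → V by x′(0) = x₀′ and x′(t) = k(t) • x′(t−1) + h(t) • r + w(t) • ε(t) for t ≥ 1. Then for every T ∈ ℕ, x′(T) = (∏_{i=1}^{T} k(i)) • x₀′ + ρ̂(T) • r + ∑_{i=1}^{T} (∏_{j=i+1}^{T} k(j)) · w(i) • ε(i). -/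
open Finset

/-- Closed-form solution of the backdoor forward diffusion recursion
`x′_t = k_t • x′_{t−1} + h_t • r + w_t • ε_t`, where `h_t = ρ̂(t) − k_t ρ̂(t−1)`:
after `T` steps the accumulated trigger coefficient equals `ρ̂(T)`. -/
theorem backdoor_forward_diffusion_closed_form {V : Type*} [AddCommGroup V] [Module ℝ V]
    (k w ρ : ℕ → ℝ) (hρ0 : ρ 0 = 0)
    (h : ℕ → ℝ) (hh : ∀ t, 1 ≤ t → h t = ρ t - k t * ρ (t - 1))
    (ε : ℕ → V) (x₀' r : V) (x' : ℕ → V)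
    (hx0 : x' 0 = x₀')
    (hxt : ∀ t, 1 ≤ t → x' t = k t • x' (t - 1) + h t • r + w t • ε t) :
    ∀ T : ℕ,
      x' T = (∏ i ∈ Icc 1 T, k i) • x₀' + ρ T • r
        + ∑ i ∈ Icc 1 T, ((∏ j ∈ Icc (i + 1) T, k j) * w i) • ε i := by
  intro T
  induction T with
  | zero => simp [hx0, hρ0]
  | succ n ih =>
    have hsum : ∑ i ∈ Icc 1 n, ((∏ j ∈ Icc (i + 1) (n + 1), k j) * w i) • ε i
        = k (n + 1) • ∑ i ∈ Icc 1 n, ((∏ j ∈ Icc (i + 1) n, k j) * w i) • ε i := by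
      rw [smul_sum]
      refine sum_congr rfl fun i hi => ?_
      have hin : i + 1 ≤ n + 1 := Nat.succ_le_succ (mem_Icc.mp hi).2
      rw [prod_Icc_succ_top hin, smul_smul]
      congr 1
      ring
    rw [hxt (n + 1) n.succ_pos, hh (n + 1) n.succ_pos, Nat.add_sub_cancel, ih,
      prod_Icc_succ_top n.succ_pos, sum_Icc_succ_top n.succ_pos, hsum,
      Icc_eq_empty_of_lt (Nat.lt_succ_self (n + 1)), prod_empty]
    module
end

section
/- Let T ∈ ℕ with T ≥ 1, let α̂, β̂, ρ̂ : ℕ → ℝ with α̂(0) = 1, β̂(0) = 0, ρ̂(0) = 0, and α̂(t) ≠ 0 for all t. Define k(t) := α̂(t)/α̂(t−1) and h(t) := ρ̂(t) − k(t)·ρ̂(t−1) for t ≥ 1, and let w : ℕ → ℝ satisfy w(t)² = β̂(t)² − ∑_{i=1}^{t−1} ((∏_{j=i+1}^{t} k(j)) · w(i))² for every t ≥ 1. Fix x₀, r ∈ ℝ, and for ε : Fin T → ℝ define X_T(ε) recursively by x(0) = x₀ and x(t) = k(t)·x(t−1) + h(t)·r + w(t)·ε(t) for 1 ≤ t ≤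 T, with X_T(ε) := x(T). Then the pushforward of the product of T copies of the standard Gaussian N(0,1) under X_T equals the Gaussian probability measure on ℝ with mean α̂(T)·x₀ + ρ̂(T)·r and variance β̂(T)². -/
open MeasureTheory ProbabilityTheory Finset

/-- A linear combination of independent standard Gaussians, shifted by a constant, is Gaussian. -/
lemma map_const_add_sum_mul_pi_gaussianReal {ι : Type*} [Fintype ι] (m : ℝ) (c : ι → ℝ) :
    Measure.map (fun ε : ι → ℝ => m + ∑ i, c i * ε i)
        (Measure.pi fun _ : ι => gaussianReal 0 1)
      = gaussianReal m (∑ i, c i ^ 2).toNNReal := by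
  have hscale : (Measure.pi fun _ : ι => gaussianReal 0 1).map (fun ε i => c i * ε i)
      = Measure.pi fun i => gaussianReal 0 (c i ^ 2).toNNReal := by
    have hc : ∀ i, (gaussianReal 0 1).map (fun x => c i * x)
        = gaussianReal 0 (c i ^ 2).toNNReal := by
      intro i
      rw [gaussianReal_map_const_mul, mul_zero, mul_one, Real.toNNReal_of_nonneg (sq_nonneg _)]
    simp_rw [← hc]
    have : ∀ i, IsProbabilityMeasure ((gaussianReal 0 1).map (fun x => c i * x)) := fun i => by
      rw [hc]; infer_instance
    exact Measure.pi_map_pi (μ := fun _ : ι => gaussianReal 0 1) (f := fun i x => c i * x)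
      fun i => by fun_prop
  have hsum : (Measure.pi fun i => gaussianReal 0 (c i ^ 2).toNNReal).map (fun x => ∑ i, x i)
      = gaussianReal 0 (∑ i, c i ^ 2).toNNReal := by
    refine Measure.ext_of_charFun ?_
    rw [charFun_map_sum_pi_eq_prod]
    ext t
    rw [Finset.prod_apply]
    simp_rw [charFun_gaussianReal]
    rw [← Complex.exp_sum, Real.coe_toNNReal _ (sum_nonneg fun i _ => sq_nonneg (c i))]
    simp_rw [Real.coe_toNNReal _ (sq_nonneg _)]
    push_cast
    simp [sum_mul, sum_div]
  have hcomp : (fun ε : ι → ℝ => m + ∑ i, c i * ε i)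
      = (fun y => m + y) ∘ (fun x : ι → ℝ => ∑ i, x i) ∘ fun ε i => c i * ε i := rfl
  rw [hcomp, ← Measure.map_map (by fun_prop) (by fun_prop),
    ← Measure.map_map (by fun_prop) (by fun_prop), hscale, hsum, gaussianReal_map_const_add,
    zero_add]

/-- Closed form of the affine recursion driving the forward process. -/
lemma affine_recursion_eq {T : ℕ} {α ρ k h w : ℕ → ℝ}
    (hα0 : α 0 = 1) (hρ0 : ρ 0 = 0) (hαne : ∀ t, α t ≠ 0)
    (hk : ∀ t, 1 ≤ t → k t = α t / α (t - 1))
    (hh : ∀ t, 1 ≤ t → h t = ρ t - k t * ρ (t - 1)) (r : ℝ) (x e : ℕ → ℝ)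
    (hx : ∀ t < T, x (t + 1) = k (t + 1) * x t + h (t + 1) * r + w (t + 1) * e t) :
    ∀ t ≤ T, x t = α t * x 0 + ρ t * r
      + ∑ i ∈ range t, α t / α (i + 1) * w (i + 1) * e i := by
  intro t
  induction t with
  | zero => simp [hα0, hρ0]
  | succ t ih =>
    intro ht
    have hstep : ∑ i ∈ range t, α (t + 1) / α (i + 1) * w (i + 1) * e i
        = α (t + 1) / α t * ∑ i ∈ range t, α t / α (i + 1) * w (i + 1) * e i := by
      rw [mul_sum]
      refine sum_congr rfl fun i _ => ?_
      field_simp [hαne]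
    rw [hx t ht, ih (by omega), hh _ (by omega), hk _ (by omega), sum_range_succ, hstep,
      div_self (hαne _), Nat.add_sub_cancel]
    field_simp [hαne]
    ring

/-- Ratios of consecutive values telescope. -/
lemma prod_Icc_ratio {α k : ℕ → ℝ} (hαne : ∀ t, α t ≠ 0)
    (hk : ∀ t, 1 ≤ t → k t = α t / α (t - 1)) {s t : ℕ} (hst : s ≤ t) :
    ∏ j ∈ Icc (s + 1) t, k j = α t / α s := by
  induction t, hst using Nat.le_induction with
  | base => simp [hαne]
  | succ t hst ih =>
    rw [prod_Icc_succ_top (by omega), ih, hk _ (by omega), Nat.add_sub_cancel]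
    field_simp [hαne]

/-- The backdoor forward diffusion process satisfies
`q(x′_T | x′_0) = N(α̂(T)x′_0 + ρ̂(T)r, β̂(T)²)` when the per-step coefficients
`k_t, h_t, w_t` are chosen by the stated numerical formulas. -/
theorem backdoor_forward_marginal (T : ℕ) (hT : 1 ≤ T)
    (α β ρ : ℕ → ℝ)
    (hα0 : α 0 = 1) (hβ0 : β 0 = 0) (hρ0 : ρ 0 = 0) (hαne : ∀ t, α t ≠ 0)
    (k h : ℕ → ℝ)
    (hk : ∀ t, 1 ≤ t → k t = α t / α (t - 1))
    (hh : ∀ t, 1 ≤ t → h t = ρ t - k t * ρ (t - 1))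
    (w : ℕ → ℝ)
    (hw : ∀ t, 1 ≤ t →
      w t ^ 2 = β t ^ 2 - ∑ i ∈ Icc 1 (t - 1), ((∏ j ∈ Icc (i + 1) t, k j) * w i) ^ 2)
    (x₀ r : ℝ)
    (X : (Fin T → ℝ) → ℕ → ℝ)
    (hX0 : ∀ ε, X ε 0 = x₀)
    (hXt : ∀ ε t (ht1 : 1 ≤ t) (htT : t ≤ T),
      X ε t = k t * X ε (t - 1) + h t * r + w t * ε ⟨t - 1, by omega⟩) :
    Measure.map (fun ε : Fin T → ℝ => X ε T)
        (Measure.pi fun _ : Fin T => gaussianReal 0 1)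
      = gaussianReal (α T * x₀ + ρ T * r) ((β T ^ 2).toNNReal) := by
  have hX : ∀ ε, X ε T = α T * x₀ + ρ T * r
      + ∑ i : Fin T, α T / α (i + 1) * w (i + 1) * ε i := by
    intro ε
    rw [affine_recursion_eq (w := w) hα0 hρ0 hαne hk hh r (X ε)
      (fun i => if hi : i < T then ε ⟨i, hi⟩ else 0) (fun t ht => by
        simpa [ht] using hXt ε (t + 1) (by omega) ht) T le_rfl, hX0, sum_range]
    simp
  have hβ : ∑ i : Fin T, (α T / α (i + 1) * w (i + 1)) ^ 2 = β T ^ 2 := by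
    obtain ⟨n, rfl⟩ : ∃ n, T = n + 1 := ⟨T - 1, by omega⟩
    have hprod : ∑ i ∈ Icc 1 n, ((∏ j ∈ Icc (i + 1) (n + 1), k j) * w i) ^ 2
        = ∑ i ∈ Icc 1 n, (α (n + 1) / α i * w i) ^ 2 :=
      sum_congr rfl fun i hi => by
        rw [prod_Icc_ratio hαne hk ((mem_Icc.mp hi).2.trans n.le_succ)]
    rw [eq_comm, ← sub_eq_zero, Fin.sum_univ_eq_sum_range
      (fun i => (α (n + 1) / α (i + 1) * w (i + 1)) ^ 2), sum_range_succ, div_self (hαne _),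
      one_mul, hw (n + 1) hT, Nat.add_sub_cancel, range_eq_Ico,
      sum_Ico_add' (fun i => (α (n + 1) / α i * w i) ^ 2) 0 n 1, zero_add,
      Ico_add_one_right_eq_Icc, hprod]
    ring
  simp_rw [hX]
  rw [map_const_add_sum_mul_pi_gaussianReal, hβ]
end

section
/- Let k, h, α′, ρ′, x₀, r ∈ ℝ and let w, β′ > 0. Define D := k²·β′² + w², a := k·β′²/D, b := α′·w²/D, c := (w²·ρ′ − k·h·β′²)/D, ρ := k·ρ′ + h, and s² := w²·β′²/D. Then for all x_t, x_{t−1} ∈ ℝ, φ(x_t; k·x_{t−1} + h·r, w²) · φ(x_{t−1}; α′·x₀ + ρ′·r, β′²) = φ(x_{t−1}; a·x_t + b·x₀ + c·r, s²) · φ(x_t; k·α′·x₀ + ρ·r, D). -/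
open MeasureTheory ProbabilityTheory

/-- Two products of Gaussian densities agree when the products of the variances and the sums of
the exponents agree. -/
theorem gaussianPDFReal_mul_eq_mul {μ₁ μ₂ μ₃ μ₄ v₁ v₂ v₃ v₄ x₁ x₂ x₃ x₄ : ℝ}
    (h₁ : 0 ≤ v₁) (h₂ : 0 ≤ v₂) (h₃ : 0 ≤ v₃) (h₄ : 0 ≤ v₄) (hv : v₁ * v₂ = v₃ * v₄)
    (hexp : -(x₁ - μ₁) ^ 2 / (2 * v₁) + -(x₂ - μ₂) ^ 2 / (2 * v₂)
      = -(x₃ - μ₃) ^ 2 / (2 * v₃) + -(x₄ - μ₄) ^ 2 / (2 * v₄)) :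
    gaussianPDFReal μ₁ v₁.toNNReal x₁ * gaussianPDFReal μ₂ v₂.toNNReal x₂
      = gaussianPDFReal μ₃ v₃.toNNReal x₃ * gaussianPDFReal μ₄ v₄.toNNReal x₄ := by
  have hπ := Real.pi_pos.le
  simp only [gaussianPDFReal, Real.coe_toNNReal, h₁, h₂, h₃, h₄]
  rw [mul_mul_mul_comm, mul_mul_mul_comm _ _ (√(2 * Real.pi * v₄))⁻¹, ← Real.exp_add,
    ← Real.exp_add, hexp, ← mul_inv, ← mul_inv, ← Real.sqrt_mul (by positivity),
    ← Real.sqrt_mul (by positivity), mul_mul_mul_comm, hv, mul_mul_mul_comm _ v₃]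

/-- The backdoor conditional reverse transition: with backdoor forward transition
`N(k x′_{t−1} + h r, w²)` and conditional marginal `N(α′ x′_0 + ρ′ r, β′²)`,
Bayes' rule gives the conditional reverse transition
`N(a x′_t + b x′_0 + c r, s²)` with `c = (w²ρ′ − k h β′²)/D`, written in
cross-multiplied form. -/
theorem backdoor_reverse_transition
    (k h α' ρ' x₀ r : ℝ) (w β' : ℝ) (hw : 0 < w) (hβ' : 0 < β')
    (D a b c ρ s2 : ℝ)
    (hD : D = k ^ 2 * β' ^ 2 + w ^ 2)
    (ha : a = k * β' ^ 2 / D) (hb : b = α' * w ^ 2 / D)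
    (hc : c = (w ^ 2 * ρ' - k * h * β' ^ 2) / D)
    (hρ : ρ = k * ρ' + h)
    (hs2 : s2 = w ^ 2 * β' ^ 2 / D)
    (xt xtm : ℝ) :
    gaussianPDFReal (k * xtm + h * r) ((w ^ 2).toNNReal) xt *
        gaussianPDFReal (α' * x₀ + ρ' * r) ((β' ^ 2).toNNReal) xtm
      = gaussianPDFReal (a * xt + b * x₀ + c * r) (s2.toNNReal) xtm *
          gaussianPDFReal (k * α' * x₀ + ρ * r) (D.toNNReal) xt := by
  have hDpos : 0 < D := by rw [hD]; positivity
  have hs2_nonneg : 0 ≤ s2 := by rw [hs2]; positivity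
  refine gaussianPDFReal_mul_eq_mul (sq_nonneg w) (sq_nonneg β') hs2_nonneg hDpos.le ?_ ?_
  · rw [hs2]
    field_simp
  · subst ha hb hc hρ hs2
    field_simp
    rw [hD]
    ring
end

section
/- Let ν be a probability measure on ℝ, let α ∈ ℝ, and let β > 0. Define p : ℝ → ℝ by p(x) := ∫ φ(x; α·x₀, β²) dν(x₀). Then for every x ∈ ℝ, p has derivative at x equal to ∫ (−(x − α·x₀)/β²) · φ(x; α·x₀, β²) dν(x₀). -/
open MeasureTheory ProbabilityTheory

open scoped NNReal

lemma hasDerivAt_gaussianPDFReal (μ : ℝ) (v : ℝ≥0) (x : ℝ) :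
    HasDerivAt (gaussianPDFReal μ v) (-(x - μ) / v * gaussianPDFReal μ v x) x := by
  have h : HasDerivAt (fun y : ℝ => -(y - μ) ^ 2 / (2 * v)) (-(x - μ) / v) x := by
    refine ((((hasDerivAt_id' x).sub_const μ).fun_pow 2).fun_neg.div_const
      (2 * (v : ℝ))).congr_deriv ?_
    rw [← mul_div_mul_left (-(x - μ)) (v : ℝ) two_ne_zero]
    congr 1
    norm_num
    ring
  rw [gaussianPDFReal_def]
  exact (h.exp.const_mul (√(2 * Real.pi * v))⁻¹).congr_deriv (by ring)

lemma gaussianPDFReal_le (μ : ℝ) (v : ℝ≥0) (x : ℝ) :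
    gaussianPDFReal μ v x ≤ (√(2 * Real.pi * v))⁻¹ := by
  rw [gaussianPDFReal_def]
  refine mul_le_of_le_one_right (by positivity) (Real.exp_le_one_iff.2 ?_)
  exact div_nonpos_of_nonpos_of_nonneg (neg_nonpos.2 (sq_nonneg _)) (by positivity)

lemma abs_mul_exp_neg_sq_div_le {v : ℝ} (hv : 0 < v) (u : ℝ) :
    |u| * Real.exp (-u ^ 2 / (2 * v)) ≤ 1 + v := by
  have h : |u| ≤ (1 + v) * (u ^ 2 / (2 * v) + 1) := by
    have : (1 + v) * (u ^ 2 / (2 * v) + 1) = u ^ 2 / (2 * v) + 1 + v + u ^ 2 / 2 := by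
      field_simp
      ring
    have : 0 ≤ u ^ 2 / (2 * v) := by positivity
    nlinarith [sq_nonneg (|u| - 1), sq_abs u]
  calc |u| * Real.exp (-u ^ 2 / (2 * v))
      ≤ ((1 + v) * Real.exp (u ^ 2 / (2 * v))) * Real.exp (-u ^ 2 / (2 * v)) := by
        gcongr
        exact h.trans (by gcongr; exact Real.add_one_le_exp _)
    _ = 1 + v := by
        rw [mul_assoc, ← Real.exp_add, neg_div, add_neg_cancel, Real.exp_zero, mul_one]

lemma norm_deriv_gaussianPDFReal_le (μ : ℝ) {v : ℝ≥0} (hv : v ≠ 0) (x : ℝ) :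
    ‖-(x - μ) / v * gaussianPDFReal μ v x‖ ≤ (√(2 * Real.pi * v))⁻¹ * (1 + v) / v := by
  have hv' : (0 : ℝ) < v := by exact_mod_cast pos_iff_ne_zero.2 hv
  calc ‖-(x - μ) / v * gaussianPDFReal μ v x‖
      = (√(2 * Real.pi * v))⁻¹ * (|x - μ| * Real.exp (-(x - μ) ^ 2 / (2 * v))) / v := by
        rw [norm_mul, Real.norm_of_nonneg (gaussianPDFReal_nonneg μ v x), Real.norm_eq_abs,
          abs_div, abs_neg, abs_of_pos hv', gaussianPDFReal_def]
        ring
    _ ≤ _ := by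
        gcongr
        exact abs_mul_exp_neg_sq_div_le hv' _

/-- Differentiation under the integral against the Gaussian kernel: the marginal
density `p(x) = ∫ φ(x; α·x₀, β²) dν(x₀)` has derivative
`∫ (−(x − α·x₀)/β²)·φ(x; α·x₀, β²) dν(x₀)` at every `x`. -/
theorem marginal_density_hasDerivAt
    (ν : Measure ℝ) [IsProbabilityMeasure ν] (α β : ℝ) (hβ : 0 < β) (x : ℝ) :
    HasDerivAt (fun y => ∫ x₀, gaussianPDFReal (α * x₀) ((β ^ 2).toNNReal) y ∂ν)
      (∫ x₀, (-(x - α * x₀) / β ^ 2) *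
        gaussianPDFReal (α * x₀) ((β ^ 2).toNNReal) x ∂ν) x := by
  have hv : (β ^ 2).toNNReal ≠ 0 := (Real.toNNReal_pos.2 (by positivity)).ne'
  have hcoe : β ^ 2 = ((β ^ 2).toNNReal : ℝ) := (Real.coe_toNNReal _ (sq_nonneg β)).symm
  generalize (β ^ 2).toNNReal = v at hv hcoe ⊢
  rw [hcoe]
  have hmeas (y : ℝ) : Measurable fun x₀ => gaussianPDFReal (α * x₀) v y :=
    measurable_uncurry_gaussianPDFReal.comp
      (f := fun x₀ : ℝ => (α * x₀, v, y)) (by fun_prop)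
  refine (hasDerivAt_integral_of_dominated_loc_of_deriv_le
    (F' := fun y x₀ => -(y - α * x₀) / v * gaussianPDFReal (α * x₀) v y)
    Filter.univ_mem (.of_forall fun y => (hmeas y).aestronglyMeasurable) ?_ ?_
    (.of_forall fun x₀ y _ => norm_deriv_gaussianPDFReal_le (α * x₀) hv y)
    (integrable_const _)
    (.of_forall fun x₀ y _ => hasDerivAt_gaussianPDFReal (α * x₀) v y)).2
  · refine (integrable_const (√(2 * Real.pi * v))⁻¹).mono' (hmeas x).aestronglyMeasurable
      (.of_forall fun x₀ => ?_)
    rw [Real.norm_of_nonneg (gaussianPDFReal_nonneg _ _ _)]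
    exact gaussianPDFReal_le _ _ _
  · exact (Measurable.mul (by fun_prop) (hmeas x)).aestronglyMeasurable
end

section
/- Let k : ℕ → ℝ and ρ̂ : ℕ → ℝ with ρ̂(0) = 0, and let h : ℕ → ℝ satisfy h(t) = ρ̂(t) − ∑_{i=1}^{t−1} (∏_{j=i+1}^{t} k(j)) · h(i) for every t ≥ 1. Then for every t ≥ 1: (1) ∑_{i=1}^{t} (∏_{j=i+1}^{t} k(j)) · h(i) = ρ̂(t), and (2) h(t) = ρ̂(t) − k(t)·ρ̂(t−1). -/
open Finset

/-- The recursively defined per-step correction coefficients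
`h(t) = ρ̂(t) − ∑_{i=1}^{t−1} (∏_{j=i+1}^{t} k_j) h_i` accumulate exactly to `ρ̂(t)` and
admit the closed two-term form `h(t) = ρ̂(t) − k_t ρ̂(t−1)`. -/
theorem correction_coefficients (k ρ : ℕ → ℝ) (hρ0 : ρ 0 = 0)
    (h : ℕ → ℝ)
    (hh : ∀ t, 1 ≤ t →
      h t = ρ t - ∑ i ∈ Icc 1 (t - 1), (∏ j ∈ Icc (i + 1) t, k j) * h i) :
    ∀ t, 1 ≤ t →
      (∑ i ∈ Icc 1 t, (∏ j ∈ Icc (i + 1) t, k j) * h i) = ρ t ∧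
      h t = ρ t - k t * ρ (t - 1) := by
  have hsum : ∀ t, 1 ≤ t →
      (∑ i ∈ Icc 1 t, (∏ j ∈ Icc (i + 1) t, k j) * h i) = ρ t := by
    intro t ht
    obtain ⟨n, rfl⟩ := Nat.exists_eq_add_of_le' ht
    have hn := hh (n + 1) ht
    rw [Nat.add_sub_cancel] at hn
    rw [sum_Icc_succ_top ht, hn, Icc_eq_empty (a := n + 1 + 1) (by omega), prod_empty]
    ring
  intro t ht
  refine ⟨hsum t ht, ?_⟩
  obtain ⟨n, rfl⟩ := Nat.exists_eq_add_of_le' ht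
  rw [hh (n + 1) ht, Nat.add_sub_cancel]
  congr 1
  have hstep : (∑ i ∈ Icc 1 n, (∏ j ∈ Icc (i + 1) (n + 1), k j) * h i) =
      k (n + 1) * ∑ i ∈ Icc 1 n, (∏ j ∈ Icc (i + 1) n, k j) * h i := by
    rw [mul_sum]
    refine sum_congr rfl fun i hi => ?_
    have hin := (mem_Icc.mp hi).2
    rw [prod_Icc_succ_top (by omega)]
    ring
  rw [hstep]
  rcases Nat.eq_zero_or_pos n with rfl | hn
  · simp [hρ0]
  · rw [hsum n hn]
end

section
/- Let k, α′ ∈ ℝ with k·α′ ≠ 0, let w, β′ > 0, let β ∈ ℝ, and let x_t, ε, ε̂ ∈ ℝ. Define D := k²·β′² + w², a := k·β′²/D, b := α′·w²/D, s² := w²·β′²/D, α := k·α′, μ := a·x_t + b·(x_t − β·ε)/α, and μ̂ := a·x_t + b·(x_t − β·ε̂)/α. Then the Kullback–Leibler divergence of the Gaussian measure with mean μ and variance s² with respect to the Gaussian measure with mean μ̂ and variance s² equals ( (α′·w²·β)/(D·α) )² · (ε − ε̂)² / (2·s²), which simplifies to (w²·β²)/(2·k²·β′²·D) · (ε − ε̂)².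 -/
open MeasureTheory ProbabilityTheory

/-- The Kullback–Leibler divergence `∫ log(dP/dQ) dP`. -/
noncomputable def klDiv {α : Type*} [MeasurableSpace α] (P Q : Measure α) : ℝ :=
  ∫ x, MeasureTheory.llr P Q x ∂P

/-- The log-likelihood ratio of two real Gaussian measures with the same nonzero variance is
affine. -/
lemma llr_gaussianReal_same_variance (m n : ℝ) {v : NNReal} (hv : v ≠ 0) :
    llr (gaussianReal m v) (gaussianReal n v)
      =ᵐ[gaussianReal m v] fun x ↦ (m - n) / v * x - (m ^ 2 - n ^ 2) / (2 * v) := by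
  have hac : gaussianReal m v ≪ gaussianReal n v :=
    (gaussianReal_absolutelyContinuous m hv).trans (gaussianReal_absolutelyContinuous' n hv)
  apply (gaussianReal_absolutelyContinuous m hv).ae_le
  filter_upwards [Measure.rnDeriv_mul_rnDeriv (κ := volume) hac, rnDeriv_gaussianReal m v,
    rnDeriv_gaussianReal n v] with x hx hm hn
  have hv' : (v : ℝ) ≠ 0 := by exact_mod_cast hv
  rw [Pi.mul_apply, hm, hn] at hx
  have hr := congrArg ENNReal.toReal hx
  rw [ENNReal.toReal_mul, toReal_gaussianPDF, toReal_gaussianPDF] at hr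
  have hpdf : gaussianPDFReal m v x
      = Real.exp ((m - n) / v * x - (m ^ 2 - n ^ 2) / (2 * v)) * gaussianPDFReal n v x := by
    simp only [gaussianPDFReal]
    rw [mul_left_comm, ← Real.exp_add]
    congr 2
    field_simp
    ring
  rw [hpdf] at hr
  rw [llr, mul_right_cancel₀ (gaussianPDFReal_pos n v x hv).ne' hr, Real.log_exp]

/-- The Kullback–Leibler divergence of two real Gaussian measures with the same nonzero
variance. -/
lemma klDiv_gaussianReal_same_variance (m n : ℝ) {v : NNReal} (hv : v ≠ 0) :
    klDiv (gaussianReal m v) (gaussianReal n v) = (m - n) ^ 2 / (2 * v) := by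
  have hv' : (v : ℝ) ≠ 0 := by exact_mod_cast hv
  have hint : Integrable (fun x : ℝ ↦ x) (gaussianReal m v) :=
    (memLp_id_gaussianReal 1).integrable le_rfl
  rw [klDiv, integral_congr_ae (llr_gaussianReal_same_variance m n hv),
    integral_sub (hint.const_mul _) (integrable_const _), integral_const_mul,
    integral_id_gaussianReal, integral_const, probReal_univ, one_smul]
  field_simp
  ring

/-- The KL term of the variational bound is proportional to `(ε − ε̂)²`: the divergence
between the true reverse-transition Gaussian (with `x₀` expressed via the
reparametrization `x₀ = (x_t − β ε)/α`) and the learned one (with `ε` replaced by `ε̂`)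
equals `((α′w²β)/(Dα))²(ε − ε̂)²/(2s²) = (w²β²)/(2k²β′²D) · (ε − ε̂)²`. -/
theorem klDiv_reverse_transition_denoising_loss
    (k α' : ℝ) (hkα : k * α' ≠ 0) (w β' : ℝ) (hw : 0 < w) (hβ' : 0 < β')
    (β xt ε ε' : ℝ)
    (D a b s2 α μ μ' : ℝ)
    (hD : D = k ^ 2 * β' ^ 2 + w ^ 2)
    (ha : a = k * β' ^ 2 / D) (hb : b = α' * w ^ 2 / D)
    (hs2 : s2 = w ^ 2 * β' ^ 2 / D)
    (hα : α = k * α')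
    (hμ : μ = a * xt + b * ((xt - β * ε) / α))
    (hμ' : μ' = a * xt + b * ((xt - β * ε') / α)) :
    klDiv (gaussianReal μ s2.toNNReal) (gaussianReal μ' s2.toNNReal)
        = (α' * w ^ 2 * β / (D * α)) ^ 2 * (ε - ε') ^ 2 / (2 * s2) ∧
      (α' * w ^ 2 * β / (D * α)) ^ 2 * (ε - ε') ^ 2 / (2 * s2)
        = w ^ 2 * β ^ 2 / (2 * k ^ 2 * β' ^ 2 * D) * (ε - ε') ^ 2 := by
  have hk : k ≠ 0 := left_ne_zero_of_mul hkα
  have hα' : α' ≠ 0 := right_ne_zero_of_mul hkα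
  have hDpos : 0 < D := by rw [hD]; positivity
  have hs2pos : 0 < s2 := by rw [hs2]; positivity
  have hmean : μ - μ' = -(α' * w ^ 2 * β / (D * α) * (ε - ε')) := by
    rw [hμ, hμ', hb, hα]
    field_simp
    ring
  constructor
  · rw [klDiv_gaussianReal_same_variance _ _ (Real.toNNReal_pos.2 hs2pos).ne',
      Real.coe_toNNReal _ hs2pos.le, hmean, neg_sq, mul_pow]
  · rw [hs2, hα]
    field_simp
end
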